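/- For four points p1,…,p4 ∈ ℝ³ with p31 × p32 ≠ 0, define the projection variables ζ2 = ‖p21‖, ζ3 = ⟨p31, p21⟩, φ3 = ⟨p31, n123 × p21⟩, ζ4 = ⟨p41, p21⟩, φ4 = ⟨p41, n123 × p21⟩, ϑ4 = ⟨p41, n123⟩, where pji := pi − pj and n123 = (p31 × p32)/‖p31 × p32‖. If p̂1,…,p̂4 ∈ ℝ³ also satisfy p̂31 × p̂32 ≠ 0 and have projection variables ζ̂2, ζ̂3, φ̂3, ζ̂4, φ̂4, ϑ̂4 defined analogously, then the two quadruples are related by a direct isometry (there exist R ∈ SO(3) and d ∈ ℝ³ with p̂i = R·pi + d for all i) if and only if (ζ2, ζ3, φ3, ζ4, φ4, ϑ4) = (ζ̂2, ζ̂3, φ̂3, ζ̂4, φ̂4, ϑ̂4). -/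

import Mathlib

open scoped RealInnerProductSpace
open Real Filter

noncomputable section

/-- Euclidean 3-space. -/
abbrev E3 : Type := EuclideanSpace ℝ (Fin 3)

/-- The cross product on `ℝ³`. -/
def cross3 (a b : E3) : E3 :=
  (WithLp.equiv 2 (Fin 3 → ℝ)).symm
    ![a 1 * b 2 - a 2 * b 1, a 2 * b 0 - a 0 * b 2, a 0 * b 1 - a 1 * b 0]

/-- The signed volume of the tetrahedron spanned by four points of `ℝ³`. -/
def signedVol (p1 p2 p3 p4 : E3) : ℝ :=
  -(1/6) * ⟪p1 - p4, cross3 (p2 - p4) (p3 - p4)⟫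

/-- The affine map `x ↦ R·x + d` on `ℝ³`. -/
def rigid (R : Matrix (Fin 3) (Fin 3) ℝ) (d : E3) (x : E3) : E3 :=
  (WithLp.equiv 2 (Fin 3 → ℝ)).symm (R.mulVec ((WithLp.equiv 2 (Fin 3 → ℝ)) x)) + d

/-- The unit normal `n123 = (p31 × p32)/‖p31 × p32‖` of the triangle `1-2-3`,
where `pji := pi − pj`. -/
def unitNormal123 (p1 p2 p3 : E3) : E3 :=
  ‖cross3 (p1 - p3) (p2 - p3)‖⁻¹ • cross3 (p1 - p3) (p2 - p3)

/-- The linear part of `rigid`. -/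
def rotate (R : Matrix (Fin 3) (Fin 3) ℝ) (v : E3) : E3 :=
  (WithLp.equiv 2 (Fin 3 → ℝ)).symm (R.mulVec ((WithLp.equiv 2 (Fin 3 → ℝ)) v))

theorem rigid_sub_rigid (R : Matrix (Fin 3) (Fin 3) ℝ) (d x y : E3) :
    rigid R d x - rigid R d y = rotate R (x - y) := by
  simp [rigid, rotate, Matrix.mulVec_sub]

theorem rotate_smul (R : Matrix (Fin 3) (Fin 3) ℝ) (c : ℝ) (v : E3) :
    rotate R (c • v) = c • rotate R v := by
  simp [rotate, Matrix.mulVec_smul]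

theorem inner_eq_dotProduct (a b : E3) : ⟪a, b⟫ = a.ofLp ⬝ᵥ b.ofLp := by
  rw [EuclideanSpace.inner_eq_star_dotProduct, dotProduct_comm]
  rfl

theorem inner_eq_sum (a b : E3) : ⟪a, b⟫ = a 0 * b 0 + a 1 * b 1 + a 2 * b 2 := by
  rw [inner_eq_dotProduct]
  simp [dotProduct, Fin.sum_univ_three]

theorem inner_rotate {R : Matrix (Fin 3) (Fin 3) ℝ} (hR : R.transpose * R = 1) (a b : E3) :
    ⟪rotate R a, rotate R b⟫ = ⟪a, b⟫ := by
  simp [inner_eq_dotProduct, rotate, Matrix.dotProduct_mulVec,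
    ← Matrix.mulVec_transpose, Matrix.mulVec_mulVec, hR]

theorem norm_rotate {R : Matrix (Fin 3) (Fin 3) ℝ} (hR : R.transpose * R = 1) (a : E3) :
    ‖rotate R a‖ = ‖a‖ := by
  rw [norm_eq_sqrt_real_inner, norm_eq_sqrt_real_inner, inner_rotate hR]

theorem rotate_transpose_cross3 (R : Matrix (Fin 3) (Fin 3) ℝ) (a b : E3) :
    rotate R.transpose (cross3 (rotate R a) (rotate R b)) = R.det • cross3 a b := by
  ext i
  fin_cases i <;>
    simp [rotate, cross3, Matrix.mulVec, dotProduct, Fin.sum_univ_three, Matrix.det_fin_three] <;>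
    ring

theorem rotate_rotate (R S : Matrix (Fin 3) (Fin 3) ℝ) (a : E3) :
    rotate R (rotate S a) = rotate (R * S) a := by
  simp [rotate]

theorem rotate_one (a : E3) : rotate 1 a = a := by
  simp [rotate]

theorem cross3_rotate {R : Matrix (Fin 3) (Fin 3) ℝ} (hR : R * R.transpose = 1)
    (hdet : R.det = 1) (a b : E3) :
    cross3 (rotate R a) (rotate R b) = rotate R (cross3 a b) := by
  have h := congrArg (rotate R) (rotate_transpose_cross3 R a b)
  rwa [rotate_rotate, hR, rotate_one, hdet, one_smul] at h

theorem unitNormal123_rigid {R : Matrix (Fin 3) (Fin 3) ℝ} (hR : R * R.transpose = 1)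
    (hR' : R.transpose * R = 1) (hdet : R.det = 1) (d p1 p2 p3 : E3) :
    unitNormal123 (rigid R d p1) (rigid R d p2) (rigid R d p3) =
      rotate R (unitNormal123 p1 p2 p3) := by
  simp only [unitNormal123, rigid_sub_rigid, cross3_rotate hR hdet, norm_rotate hR', rotate_smul]

theorem norm_unitNormal123 {p1 p2 p3 : E3} (hp : cross3 (p1 - p3) (p2 - p3) ≠ 0) :
    ‖unitNormal123 p1 p2 p3‖ = 1 := by
  simp [unitNormal123, norm_smul, hp]

theorem inner_unitNormal123_left (p1 p2 p3 : E3) :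
    ⟪p1 - p3, unitNormal123 p1 p2 p3⟫ = 0 := by
  rw [unitNormal123, inner_smul_right, inner_eq_sum]
  simp [cross3]
  right
  ring

theorem inner_unitNormal123_base (p1 p2 p3 : E3) :
    ⟪p1 - p2, unitNormal123 p1 p2 p3⟫ = 0 := by
  rw [unitNormal123, inner_smul_right, inner_eq_sum]
  simp [cross3]
  right
  ring

theorem sub_ne_zero_of_cross3_ne_zero {p1 p2 p3 : E3}
    (hp : cross3 (p1 - p3) (p2 - p3) ≠ 0) : p1 - p2 ≠ 0 := by
  intro h
  obtain rfl := sub_eq_zero.mp h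
  apply hp
  ext i
  fin_cases i <;> simp [cross3] <;> ring

/-- The matrix with rows `u`, `n × u`, `n`. -/
def frame (u n : E3) : Matrix (Fin 3) (Fin 3) ℝ :=
  Matrix.of ![u.ofLp, (cross3 n u).ofLp, n.ofLp]

theorem frame_mul_transpose {u n : E3} (hu : ‖u‖ = 1) (hn : ‖n‖ = 1) (hun : ⟪u, n⟫ = 0) :
    frame u n * (frame u n).transpose = 1 := by
  have hu' : ⟪u, u⟫ = 1 := by rw [real_inner_self_eq_norm_sq, hu, one_pow]
  have hn' : ⟪n, n⟫ = 1 := by rw [real_inner_self_eq_norm_sq, hn, one_pow]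
  rw [inner_eq_sum] at hu' hn' hun
  ext i j
  fin_cases i <;> fin_cases j <;>
    simp [frame, cross3, Matrix.mul_apply, Fin.sum_univ_three] <;>
    first
    | linear_combination hu'
    | linear_combination hn'
    | linear_combination hun
    | linear_combination (n 0 * n 0 + n 1 * n 1 + n 2 * n 2) * hu' + hn' -
        (u 0 * n 0 + u 1 * n 1 + u 2 * n 2) * hun
    | ring

theorem det_frame {u n : E3} (hu : ‖u‖ = 1) (hn : ‖n‖ = 1) (hun : ⟪u, n⟫ = 0) :
    (frame u n).det = 1 := by
  have hu' : ⟪u, u⟫ = 1 := by rw [real_inner_self_eq_norm_sq, hu, one_pow]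
  have hn' : ⟪n, n⟫ = 1 := by rw [real_inner_self_eq_norm_sq, hn, one_pow]
  rw [inner_eq_sum] at hu' hn' hun
  simp [frame, cross3, Matrix.det_fin_three]
  linear_combination (n 0 * n 0 + n 1 * n 1 + n 2 * n 2) * hu' + hn' -
    (u 0 * n 0 + u 1 * n 1 + u 2 * n 2) * hun

theorem rotate_frame (u n v : E3) :
    rotate (frame u n) v =
      (WithLp.equiv 2 (Fin 3 → ℝ)).symm ![⟪v, u⟫, ⟪v, cross3 n u⟫, ⟪v, n⟫] := by
  ext i
  fin_cases i <;>
    simp [rotate, frame, inner_eq_dotProduct, dotProduct_comm]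

theorem cross3_smul (c : ℝ) (a b : E3) : cross3 a (c • b) = c • cross3 a b := by
  ext i
  fin_cases i <;> simp [cross3] <;> ring

/-- The orthonormal positively oriented frame attached to a triangle. -/
def triangleFrame (p1 p2 p3 : E3) : Matrix (Fin 3) (Fin 3) ℝ :=
  frame (‖p1 - p2‖⁻¹ • (p1 - p2)) (unitNormal123 p1 p2 p3)

theorem triangleFrame_spec {p1 p2 p3 : E3} (hp : cross3 (p1 - p3) (p2 - p3) ≠ 0) :
    triangleFrame p1 p2 p3 * (triangleFrame p1 p2 p3).transpose = 1 ∧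
      (triangleFrame p1 p2 p3).det = 1 := by
  have hu : ‖‖p1 - p2‖⁻¹ • (p1 - p2)‖ = 1 := by
    rw [norm_smul, norm_inv, norm_norm,
      inv_mul_cancel₀ (norm_ne_zero_iff.mpr (sub_ne_zero_of_cross3_ne_zero hp))]
  have hun : ⟪‖p1 - p2‖⁻¹ • (p1 - p2), unitNormal123 p1 p2 p3⟫ = 0 := by
    rw [real_inner_smul_left, inner_unitNormal123_base, mul_zero]
  exact ⟨frame_mul_transpose hu (norm_unitNormal123 hp) hun,
    det_frame hu (norm_unitNormal123 hp) hun⟩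

theorem rotate_triangleFrame (p1 p2 p3 v : E3) :
    rotate (triangleFrame p1 p2 p3) v =
      (WithLp.equiv 2 (Fin 3 → ℝ)).symm
        ![‖p1 - p2‖⁻¹ * ⟪v, p1 - p2⟫,
          ‖p1 - p2‖⁻¹ * ⟪v, cross3 (unitNormal123 p1 p2 p3) (p1 - p2)⟫,
          ⟪v, unitNormal123 p1 p2 p3⟫] := by
  simp only [triangleFrame, rotate_frame, cross3_smul, real_inner_smul_right]

theorem inner_cross3_self (a b : E3) : ⟪b, cross3 a b⟫ = 0 := by
  rw [inner_eq_sum]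
  simp [cross3]
  ring

/-- For two nondegenerate quadruples of points in `ℝ³`, the quadruples
are related by a direct isometry if and only if all six projection variables
`(ζ2, ζ3, φ3, ζ4, φ4, ϑ4)` coincide. -/
theorem strongly_congruent_iff_projection_variables_eq
    (p1 p2 p3 p4 q1 q2 q3 q4 : E3)
    (hp : cross3 (p1 - p3) (p2 - p3) ≠ 0)
    (hq : cross3 (q1 - q3) (q2 - q3) ≠ 0) :
    (∃ R : Matrix (Fin 3) (Fin 3) ℝ, ∃ d : E3,
        R ∈ Matrix.orthogonalGroup (Fin 3) ℝ ∧ R.det = 1 ∧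
        q1 = rigid R d p1 ∧ q2 = rigid R d p2 ∧ q3 = rigid R d p3 ∧ q4 = rigid R d p4) ↔
      (‖p1 - p2‖ = ‖q1 - q2‖ ∧
        ⟪p1 - p3, p1 - p2⟫ = ⟪q1 - q3, q1 - q2⟫ ∧
        ⟪p1 - p3, cross3 (unitNormal123 p1 p2 p3) (p1 - p2)⟫ =
          ⟪q1 - q3, cross3 (unitNormal123 q1 q2 q3) (q1 - q2)⟫ ∧
        ⟪p1 - p4, p1 - p2⟫ = ⟪q1 - q4, q1 - q2⟫ ∧
        ⟪p1 - p4, cross3 (unitNormal123 p1 p2 p3) (p1 - p2)⟫ =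
          ⟪q1 - q4, cross3 (unitNormal123 q1 q2 q3) (q1 - q2)⟫ ∧
        ⟪p1 - p4, unitNormal123 p1 p2 p3⟫ = ⟪q1 - q4, unitNormal123 q1 q2 q3⟫) := by
  constructor
  · rintro ⟨R, d, hR, hdet, rfl, rfl, rfl, rfl⟩
    have h₁ : R * R.transpose = 1 := (Matrix.mem_orthogonalGroup_iff (Fin 3) ℝ).mp hR
    have h₂ : R.transpose * R = 1 := (Matrix.mem_orthogonalGroup_iff' (Fin 3) ℝ).mp hR
    simp only [unitNormal123_rigid h₁ h₂ hdet, rigid_sub_rigid, cross3_rotate h₁ hdet,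
      inner_rotate h₂, norm_rotate h₂, and_self]
  · rintro ⟨hζ₂, hζ₃, hφ₃, hζ₄, hφ₄, hϑ₄⟩
    obtain ⟨hA, hAdet⟩ := triangleFrame_spec hp
    obtain ⟨hB, hBdet⟩ := triangleFrame_spec hq
    have hA' := mul_eq_one_comm.mp hA
    have hB' := mul_eq_one_comm.mp hB
    have h₂ : rotate (triangleFrame p1 p2 p3) (p1 - p2) =
        rotate (triangleFrame q1 q2 q3) (q1 - q2) := by
      simp only [rotate_triangleFrame, real_inner_self_eq_norm_sq, inner_cross3_self,
        inner_unitNormal123_base, hζ₂]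
    have h₃ : rotate (triangleFrame p1 p2 p3) (p1 - p3) =
        rotate (triangleFrame q1 q2 q3) (q1 - q3) := by
      simp only [rotate_triangleFrame, inner_unitNormal123_left, hζ₂, hζ₃, hφ₃]
    have h₄ : rotate (triangleFrame p1 p2 p3) (p1 - p4) =
        rotate (triangleFrame q1 q2 q3) (q1 - q4) := by
      simp only [rotate_triangleFrame, hζ₂, hζ₄, hφ₄, hϑ₄]
    generalize triangleFrame p1 p2 p3 = A at *
    generalize triangleFrame q1 q2 q3 = B at *
    have key {p q : E3} (h : rotate A (p1 - p) = rotate B (q1 - q)) :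
        q = rigid (B.transpose * A) (q1 - rotate (B.transpose * A) p1) p := by
      have h' := congrArg (rotate B.transpose) h
      rw [rotate_rotate, rotate_rotate, hB', rotate_one, ← rigid_sub_rigid _ 0] at h'
      simp only [rigid, rotate, add_zero] at h' ⊢
      rw [← sub_sub_cancel q1 q, ← h']
      abel
    refine ⟨B.transpose * A, q1 - rotate (B.transpose * A) p1, ?_, ?_, key ?_, key h₂, key h₃,
      key h₄⟩
    · rw [Matrix.mem_orthogonalGroup_iff', Matrix.transpose_mul,
        Matrix.transpose_transpose, Matrix.mul_assoc, ← Matrix.mul_assoc B, hB, Matrix.one_mul, hA']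
    · rw [Matrix.det_mul, Matrix.det_transpose, hAdet, hBdet, one_mul]
    · simp [rotate]
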